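/- arXiv:1007.5104 — 6 statements merged into one kernel-verified Lean document; each statement's English description precedes it below -/
import Mathlib

section
/- Let n ≥ 1 and m ≥ 1, and let B be an n×m matrix of natural numbers such that for every value k ∈ {0, …, m−1}, exactly n entries of B are equal to k. Then there exists an n×m matrix A of natural numbers such that: (i) for every k ∈ {0, …, m−1}, exactly n entries of A are equal to k; (ii) for every column j, the sum of the entries of column j of A equals the sum of the entries of column j of B; and (iii) every row of A contains each value k ∈ {0, …, m−1} exactly once (i.e., every row of A is a permutation of (0, 1, …, m−1)). -/
/-- A square matrix of naturals whose rows and columns all have the same positive sum has a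
permutation in its support. -/
theorem exists_perm_pos_of_sum_eq {ι : Type*} [Fintype ι] [DecidableEq ι] {s : ℕ} (hs : 0 < s)
    (c : ι → ι → ℕ) (hrow : ∀ i, ∑ j, c i j = s) (hcol : ∀ j, ∑ i, c i j = s) :
    ∃ σ : Equiv.Perm ι, ∀ i, 0 < c i (σ i) := by
  let f (i : ι) : Finset ι := {j | c i j ≠ 0}
  have hf (A : Finset ι) : A.card ≤ (A.biUnion f).card := by
    have hfi (i : ι) : ∑ j ∈ f i, c i j = s := by
      rw [← hrow i, Finset.sum_filter_ne_zero]
    refine le_of_mul_le_mul_right ?_ hs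
    calc A.card * s = ∑ i ∈ A, ∑ j ∈ f i, c i j := by simp [hfi]
      _ ≤ ∑ i ∈ A, ∑ j ∈ A.biUnion f, c i j := Finset.sum_le_sum fun i hi =>
          Finset.sum_le_sum_of_subset (Finset.subset_biUnion_of_mem f hi)
      _ ≤ ∑ i, ∑ j ∈ A.biUnion f, c i j := Finset.sum_le_sum_of_subset (Finset.subset_univ A)
      _ = (A.biUnion f).card * s := by rw [Finset.sum_comm]; simp [hcol]
  obtain ⟨g, hg, hgf⟩ := (Finset.all_card_le_biUnion_card_iff_exists_injective f).1 hf
  refine ⟨Equiv.ofBijective g (Finite.injective_iff_bijective.1 hg), fun i => ?_⟩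
  simpa [f, Nat.pos_iff_ne_zero] using hgf i

/-- The integral Birkhoff theorem: a square matrix of naturals with all row and column sums equal
to `n` is a sum of `n` permutation matrices. -/
theorem exists_perms_card_eq_of_sum_eq {ι : Type*} [Fintype ι] [DecidableEq ι] (n : ℕ)
    (c : ι → ι → ℕ) (hrow : ∀ i, ∑ j, c i j = n) (hcol : ∀ j, ∑ i, c i j = n) :
    ∃ σ : Fin n → Equiv.Perm ι, ∀ i j, ∑ r, (if σ r i = j then 1 else 0) = c i j := by
  induction n generalizing c with
  | zero => exact ⟨Fin.elim0, fun i j => by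
      simpa [eq_comm] using Finset.sum_eq_zero_iff.1 (hrow i) j⟩
  | succ n ih =>
    obtain ⟨τ, hτ⟩ := exists_perm_pos_of_sum_eq n.succ_pos c hrow hcol
    have hle (i j : ι) : (if τ i = j then 1 else 0) ≤ c i j := by
      split_ifs with h
      · exact h ▸ hτ i
      · exact Nat.zero_le _
    obtain ⟨σ, hσ⟩ := ih (fun i j => c i j - if τ i = j then 1 else 0)
      (fun i => by
        rw [Finset.sum_tsub_distrib _ fun j _ => hle i j, hrow]
        simp)
      (fun j => by
        rw [Finset.sum_tsub_distrib _ fun i _ => hle i j, hcol]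
        simp [← Equiv.eq_symm_apply])
    refine ⟨Fin.cons τ σ, fun i j => ?_⟩
    rw [Fin.sum_univ_succ]
    simp only [Fin.cons_zero, Fin.cons_succ, hσ]
    exact Nat.add_sub_cancel' (hle i j)


/-- Theorem 1 of the paper: an `n × m` matrix of naturals in which each value
`k ∈ {0, …, m−1}` occurs exactly `n` times can be rearranged, preserving all
column sums, so that each row becomes a permutation of `(0, …, m−1)`. -/
theorem borda_matrix_rearrangement
    (n m : ℕ) (hn : 1 ≤ n) (hm : 1 ≤ m)
    (B : Matrix (Fin n) (Fin m) ℕ)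
    (hB : ∀ k < m,
      ((Finset.univ : Finset (Fin n × Fin m)).filter
        (fun p => B p.1 p.2 = k)).card = n) :
    ∃ A : Matrix (Fin n) (Fin m) ℕ,
      (∀ k < m,
        ((Finset.univ : Finset (Fin n × Fin m)).filter
          (fun p => A p.1 p.2 = k)).card = n) ∧
      (∀ j : Fin m, ∑ r : Fin n, A r j = ∑ r : Fin n, B r j) ∧
      (∀ r : Fin n,
        Finset.univ.image (fun j : Fin m => A r j) = Finset.range m) := by
  have hlt : ∀ p : Fin n × Fin m, B p.1 p.2 < m := by
    have hcard := Finset.card_eq_sum_card_fiberwise (s := {p : Fin n × Fin m | B p.1 p.2 < m})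
      (f := fun p => B p.1 p.2) (t := Finset.range m) (fun p hp => by simpa using hp)
    have hfib : ∀ k ∈ Finset.range m,
        ({p ∈ ({p | B p.1 p.2 < m} : Finset (Fin n × Fin m)) | B p.1 p.2 = k}).card = n := by
      intro k hk
      refine Eq.trans (congrArg Finset.card ?_) (hB k (Finset.mem_range.1 hk))
      ext p
      have := Finset.mem_range.1 hk
      simp only [Finset.mem_filter, Finset.mem_univ, true_and]
      omega
    rw [Finset.sum_congr rfl hfib] at hcard
    have huniv := (Finset.card_eq_iff_eq_univ _).1 (hcard.trans (by simp [mul_comm]))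
    intro p
    exact (Finset.mem_filter.1 (huniv.symm.subset (Finset.mem_univ p))).2
  have hsum (b : Fin n → Fin m) : ∑ r, (b r : ℕ) =
      ∑ k : Fin m, (∑ r, if b r = k then 1 else 0) * (k : ℕ) := by
    simp only [Finset.sum_mul]
    rw [Finset.sum_comm]
    simp
  let b (r : Fin n) (j : Fin m) : Fin m := ⟨B r j, hlt (r, j)⟩
  obtain ⟨σ, hσ⟩ := exists_perms_card_eq_of_sum_eq n
    (fun j k : Fin m => ∑ r, if b r j = k then 1 else 0)
    (fun j => by rw [Finset.sum_comm]; simp)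
    (fun k => by
      rw [Finset.sum_comm, ← Fintype.sum_prod_type' (fun r j => if b r j = k then 1 else 0)]
      simpa [b, Fin.ext_iff] using hB k k.2)
  refine ⟨fun r j => σ r j, fun k hk => ?_, fun j => ?_, fun r => ?_⟩
  · rw [Finset.card_filter, Fintype.sum_prod_type]
    have hrow (r : Fin n) : ∑ j, (if (σ r j : ℕ) = k then 1 else 0) = 1 := by
      simp_rw [show ∀ j, (σ r j : ℕ) = k ↔ j = (σ r).symm ⟨k, hk⟩ from fun j => by
        rw [Equiv.eq_symm_apply, Fin.ext_iff]]
      simp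
    simp [hrow]
  · calc ∑ r, (σ r j : ℕ) = ∑ r, (b r j : ℕ) := by
          rw [hsum fun r => σ r j, hsum fun r => b r j]
          simp only [hσ]
      _ = ∑ r, B r j := rfl
  · ext k
    simp only [Finset.mem_image, Finset.mem_univ, true_and, Finset.mem_range]
    constructor
    · rintro ⟨j, rfl⟩
      exact (σ r j).2
    · exact fun hk => ⟨(σ r).symm ⟨k, hk⟩, by simp⟩
end

section
/- Let n ≥ 1 and m ≥ 1, and let B be an n×m matrix of natural numbers such that for every value k ∈ {0, …, m−1}, exactly n entries of B are equal to k. Then there exists a function r from the set of columns {1, …, m} to the set of rows {1, …, n} such that the map j ↦ B(r(j), j) is a bijection from {1, …, m} onto {0, …, m−1}; that is, one can select one entry from each column so that the selected entries are exactly the values 0, 1, …, m−1, each occurring once. -/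
/-- **Hall's condition** for values of a matrix against the columns in which they occur: a set of
values each occurring at least as often as there are rows meets at least as many columns. -/
theorem Matrix.card_le_card_columns_meeting {ι κ α : Type*} [Fintype ι] [Nonempty ι] [Fintype κ]
    [DecidableEq α] (B : Matrix ι κ α) (A : Finset α)
    (hA : ∀ k ∈ A,
      Fintype.card ι ≤ ((Finset.univ : Finset (ι × κ)).filter (fun p => B p.1 p.2 = k)).card) :
    A.card ≤ ((Finset.univ : Finset κ).filter (fun j => ∃ i, B i j ∈ A)).card := by
  refine Nat.le_of_mul_le_mul_left ?_ (Fintype.card_pos (α := ι))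
  let S : Finset (ι × κ) := Finset.univ.filter fun p => B p.1 p.2 ∈ A
  calc
    Fintype.card ι * A.card ≤ S.card := by
      refine Finset.mul_card_image_le_card_of_maps_to (f := fun p : ι × κ => B p.1 p.2)
        (fun p hp => (Finset.mem_filter.1 hp).2) _ fun k hk => (hA k hk).trans ?_
      refine Finset.card_le_card fun p hp => ?_
      simp_all
    _ ≤ ((Finset.univ : Finset ι) ×ˢ
          (Finset.univ : Finset κ).filter (fun j => ∃ i, B i j ∈ A)).card := by
      refine Finset.card_le_card fun p hp => ?_
      exact Finset.mem_product.2 ⟨Finset.mem_univ _, Finset.mem_filter.2 ⟨Finset.mem_univ _, p.1, (Finset.mem_filter.1 hp).2⟩⟩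
    _ = _ := by rw [Finset.card_product, Finset.card_univ]

/-- The key step (via Hall's marriage theorem) in the proof of Theorem 1 of the
paper: from an `n × m` matrix of naturals in which each value `k ∈ {0, …, m−1}`
occurs exactly `n` times, one can select one entry from each column so that the
selected entries are exactly the values `0, 1, …, m−1`, each occurring once. -/
theorem borda_matrix_transversal
    (n m : ℕ) (hn : 1 ≤ n) (hm : 1 ≤ m)
    (B : Matrix (Fin n) (Fin m) ℕ)
    (hB : ∀ k < m,
      ((Finset.univ : Finset (Fin n × Fin m)).filter
        (fun p => B p.1 p.2 = k)).card = n) :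
    ∃ r : Fin m → Fin n,
      Function.Injective (fun j : Fin m => B (r j) j) ∧
      Finset.univ.image (fun j : Fin m => B (r j) j) = Finset.range m := by
  have : Nonempty (Fin n) := ⟨⟨0, hn⟩⟩
  obtain ⟨f, hf, hfB⟩ := (Fintype.all_card_le_filter_rel_iff_exists_injective
    (fun k j : Fin m => ∃ i, B i j = k)).1 fun A => by
      refine (A.card_map Fin.valEmbedding).symm.le.trans
        ((B.card_le_card_columns_meeting (A.map Fin.valEmbedding) (by simp [hB])).trans
          (Finset.card_le_card fun j hj => ?_))
      obtain ⟨i, k, hk, hki⟩ := by simpa using hj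
      simpa using ⟨k, hk, i, hki.symm⟩
  let e : Fin m ≃ Fin m := Equiv.ofBijective f (Finite.injective_iff_bijective.1 hf)
  choose r hr using fun j => hfB (e.symm j)
  have hval (j : Fin m) : B (r j) j = e.symm j := by
    simpa [e, Equiv.ofBijective_apply_symm_apply] using hr j
  refine ⟨r, ?_, ?_⟩
  · simpa only [hval, Function.comp_def] using Fin.val_injective.comp e.symm.injective
  · ext k
    simp only [hval, Finset.mem_image, Finset.mem_univ, true_and, Finset.mem_range]
    exact ⟨fun ⟨j, hj⟩ => hj ▸ (e.symm j).isLt, fun hk => ⟨e ⟨k, hk⟩, by simp⟩⟩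
end

section
/- Let m > 2 be an even natural number. Then there exist two bijections a, b from {1, …, m−1} to {1, …, m−1} such that the map i ↦ a(i) + b(i) is a bijection from {1, …, m−1} onto {m/2 + 1, m/2 + 2, …, m/2 + (m−1)}. -/
/-- The construction in the proof of Proposition 1 of the paper: for even `m > 2`
there are two permutations `a, b` of `{1, …, m−1}` whose pointwise sum is a
bijection from `{1, …, m−1}` onto `{m/2 + 1, …, m/2 + (m−1)}`. -/
theorem borda_two_votes_construction
    (m : ℕ) (hm : 2 < m) (hme : Even m) :
    ∃ a b : ℕ → ℕ,
      Set.BijOn a (Set.Icc 1 (m - 1)) (Set.Icc 1 (m - 1)) ∧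
      Set.BijOn b (Set.Icc 1 (m - 1)) (Set.Icc 1 (m - 1)) ∧
      Set.BijOn (fun i => a i + b i) (Set.Icc 1 (m - 1))
        (Set.Icc (m / 2 + 1) (m / 2 + (m - 1))) := by
  obtain ⟨k, rfl⟩ := hme
  refine ⟨id, fun i => if i % 2 = 1 then k - i / 2 else 2 * k - i / 2,
    Set.bijOn_id _, ⟨?_, ?_, ?_⟩, ⟨?_, ?_, ?_⟩⟩
  · intro i hi
    simp only [Set.mem_Icc] at hi ⊢
    split_ifs <;> omega
  · intro i hi j hj h
    simp only [Set.mem_Icc] at hi hj h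
    split_ifs at h <;> omega
  · intro y hy
    simp only [Set.mem_Icc] at hy
    by_cases h : y ≤ k
    · refine ⟨2 * (k - y) + 1, ?_, ?_⟩
      · simp only [Set.mem_Icc]; omega
      · dsimp only; split_ifs <;> omega
    · refine ⟨2 * (2 * k - y), ?_, ?_⟩
      · simp only [Set.mem_Icc]; omega
      · dsimp only; split_ifs <;> omega
  · intro i hi
    simp only [Set.mem_Icc, id] at hi ⊢
    split_ifs <;> omega
  · intro i hi j hj h
    simp only [Set.mem_Icc, id] at hi hj h
    split_ifs at h <;> omega
  · intro y hy
    simp only [Set.mem_Icc] at hy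
    by_cases h : y ≤ 2 * k
    · refine ⟨2 * (y - k) - 1, ?_, ?_⟩
      · simp only [Set.mem_Icc]; omega
      · dsimp only [id]; split_ifs <;> omega
    · refine ⟨2 * (y - 2 * k), ?_, ?_⟩
      · simp only [Set.mem_Icc]; omega
      · dsimp only [id]; split_ifs <;> omega
end

section
/- Let m > 2 be an even natural number, let d = m, and define gap values g(i) = 2(m−1) − (m/2 + i) for i ∈ {1, …, m−1}. Then (i) there exists a 2-manipulation matrix for g, i.e., a 2×m matrix A of natural numbers such that every entry of column m equals m−1, every row of A contains each value in {0, …, m−1} exactly once, and for each i < m the entries of column i sum to at most g(i); and (ii) there is no 1-manipulation matrix for the gap values g′(i) = (m−1) − (m/2 + i), i ∈ {1, …, m−1}. -/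
/-- An `n`-manipulation matrix for `m` candidates with distinguished candidate
(column) `d` and gap values `g`: every entry of column `d` equals `m−1`, every
row is a permutation of `(0, …, m−1)`, and for each column `i ≠ d` the entries
of column `i` sum to at most `g i`. -/
def IsManipMatrix (n m : ℕ) (d : Fin m) (g : Fin m → ℤ)
    (A : Matrix (Fin n) (Fin m) ℕ) : Prop :=
  (∀ r : Fin n, A r d = m - 1) ∧
  (∀ r : Fin n,
    Finset.univ.image (fun j : Fin m => A r j) = Finset.range m) ∧
  (∀ i : Fin m, i ≠ d → (∑ r : Fin n, (A r i : ℤ)) ≤ g i)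

/-- The rows of the two manipulators for `2 * t + 2` candidates: columns `j ≤ 2 * t` have sum `3 * t - j`,
and column `2 * t + 1` is ranked first by both. -/
def twoManipulators (t : ℕ) : Matrix (Fin 2) (Fin (2 * t + 2)) ℕ := fun r j =>
  if (j : ℕ) = 2 * t + 1 then 2 * t + 1
  else if r = 0 then
    if (j : ℕ) % 2 = 0 then t - j / 2 else 2 * t - j / 2
  else
    if (j : ℕ) % 2 = 0 then 2 * t - j / 2 else t - 1 - j / 2

lemma image_twoManipulators (t : ℕ) (r : Fin 2) :
    Finset.univ.image (fun j => twoManipulators t r j) = Finset.range (2 * t + 2) := by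
  ext a
  simp only [Finset.mem_image, Finset.mem_univ, true_and, Finset.mem_range]
  constructor
  · rintro ⟨j, rfl⟩
    unfold twoManipulators
    split_ifs <;> omega
  · intro ha
    rcases Nat.lt_or_ge (2 * t) a with h | h
    · exact ⟨⟨2 * t + 1, by omega⟩, by simp only [twoManipulators, if_true]; omega⟩
    · fin_cases r
      · rcases Nat.lt_or_ge t a with h' | h'
        · refine ⟨⟨2 * (2 * t - a) + 1, by omega⟩, ?_⟩
          simp only [twoManipulators]
          split_ifs <;> first | omega | simp_all
        · refine ⟨⟨2 * (t - a), by omega⟩, ?_⟩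
          simp only [twoManipulators]
          split_ifs <;> first | omega | simp_all
      · rcases Nat.lt_or_ge a t with h' | h'
        · refine ⟨⟨2 * (t - 1 - a) + 1, by omega⟩, ?_⟩
          simp only [twoManipulators]
          split_ifs <;> first | omega | simp_all
        · refine ⟨⟨2 * (2 * t - a), by omega⟩, ?_⟩
          simp only [twoManipulators]
          split_ifs <;> first | omega | simp_all

/-- The positive part of Proposition 1 of the paper.  For even `m > 2`,
distinguished candidate `d = m` and pre-existing scores `m/2 + i` for
candidate `i ∈ {1, …, m−1}` (candidate `i` is column `j` with `i = j + 1`),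
two manipulators suffice (gap values `2(m−1) − (m/2 + i)`), while one
manipulator does not (gap values `(m−1) − (m/2 + i)`). -/
theorem borda_prop1_two_manipulators
    (m : ℕ) (hm : 2 < m) (hme : Even m) :
    (∃ A : Matrix (Fin 2) (Fin m) ℕ,
      IsManipMatrix 2 m ⟨m - 1, by omega⟩
        (fun j => 2 * ((m : ℤ) - 1) - ((m : ℤ) / 2 + ((j : ℕ) + 1 : ℕ))) A) ∧
    ¬ (∃ A : Matrix (Fin 1) (Fin m) ℕ,
      IsManipMatrix 1 m ⟨m - 1, by omega⟩
        (fun j => ((m : ℤ) - 1) - ((m : ℤ) / 2 + ((j : ℕ) + 1 : ℕ))) A) := by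
  constructor
  · obtain ⟨t, rfl⟩ : ∃ t, m = 2 * t + 2 := by
      obtain ⟨k, rfl⟩ := hme
      exact ⟨k - 1, by omega⟩
    refine ⟨twoManipulators t, fun r => ?_, image_twoManipulators t, fun i hi => ?_⟩
    · simp [twoManipulators]
    · have hi' : (i : ℕ) ≠ 2 * t + 1 := fun h => hi (Fin.ext h)
      simp only [Fin.sum_univ_two, twoManipulators, if_neg hi', if_true, one_ne_zero, if_false]
      split_ifs <;> push_cast <;> omega
  · rintro ⟨A, -, -, hA⟩
    have h := hA ⟨m - 2, by omega⟩ (by simp only [ne_eq, Fin.mk.injEq]; omega)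
    simp only [Fin.sum_univ_one] at h
    omega
end

section
/- Let k ≥ 1 be a natural number, let m = 4, d = 4, and consider pre-existing Borda scores s(1) = 6k, s(2) = 4k, s(3) = 2k, s(4) = 0. Then (i) there exists a 2k-manipulation matrix for the gap values g_n(i) = 3n − s(i) with n = 2k, namely the matrix in which every row assigns score 0 to candidate 1, score 1 to candidate 2, score 2 to candidate 3, and score 3 to candidate 4; and (ii) for every n < 2k there is no n-manipulation matrix for the gap values g_n(i) = 3n − s(i), since g_n(1) < 0. Hence the minimum number of manipulators needed to make candidate 4 win is exactly 2k. -/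
/-- The optimality claim from the proof of Theorem 2 of the paper: with `m = 4`
candidates, distinguished candidate `d = 4` (column `3`), and pre-existing
scores `s = (6k, 4k, 2k, 0)`, the matrix in which every manipulator votes
`4 > 3 > 2 > 1` is a `2k`-manipulation matrix for the gaps `gₙ(i) = 3n − s(i)`
with `n = 2k`, and no `n`-manipulation matrix exists for any `n < 2k`; hence
the minimum number of manipulators needed is exactly `2k`. -/
theorem borda_thm2_optimal_2k
    (k : ℕ) (hk : 1 ≤ k)
    (s : Fin 4 → ℤ)
    (hs : s = ![6 * (k : ℤ), 4 * (k : ℤ), 2 * (k : ℤ), 0]) :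
    IsManipMatrix (2 * k) 4 3 (fun i => 3 * (2 * (k : ℤ)) - s i)
      (fun _ j => (j : ℕ)) ∧
    ∀ n : ℕ, n < 2 * k →
      ¬ ∃ A : Matrix (Fin n) (Fin 4) ℕ,
          IsManipMatrix n 4 3 (fun i => 3 * (n : ℤ) - s i) A := by
  subst hs
  refine ⟨⟨fun _ => rfl, fun _ => by beta_reduce; decide, fun i hi => ?_⟩, ?_⟩
  · fin_cases i
    · simp; lia
    · simp; lia
    · simp; lia
    · exact absurd rfl hi
  · rintro n hn ⟨A, -, -, hA⟩
    have gap := hA 0 (by decide)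
    have nonneg : (0 : ℤ) ≤ ∑ r : Fin n, (A r 0 : ℤ) :=
      Finset.sum_nonneg fun _ _ => Int.natCast_nonneg _
    simp only [Matrix.cons_val_zero] at gap
    lia
end

section
/- Let k ≥ 1 be a natural number. Every 2k-manipulation matrix for m = 4, d = 4, and gap values g(1) = 0, g(2) = 2k, g(3) = 4k is equal to the matrix in which every row assigns 0 to column 1, 1 to column 2, 2 to column 3, and 3 to column 4; that is, the optimal manipulation of the election with pre-existing scores (6k, 4k, 2k, 0) by 2k manipulators is unique, with every manipulator casting the vote 4 > 3 > 2 > 1. -/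
theorem eq_const_of_sum_le {n c : ℕ} {f : Fin n → ℕ} (hc : ∀ r, c ≤ f r)
    (hsum : ∑ r, (f r : ℤ) ≤ n * c) (r : Fin n) : f r = c := by
  have hle : ∑ _r : Fin n, c ≤ ∑ r, f r := Finset.sum_le_sum fun r _ => hc r
  have hge : ∑ r, f r ≤ ∑ _r : Fin n, c := by
    simpa using (by exact_mod_cast hsum : ∑ r, f r ≤ n * c)
  exact ((Finset.sum_eq_sum_iff_of_le fun r _ => hc r).1 (hle.antisymm hge) r
    (Finset.mem_univ r)).symm

/-- The uniqueness claim from the proof of Theorem 2 of the paper: with `m = 4`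
candidates, distinguished candidate `d = 4` (column `3`), and gap values
`g = (0, 2k, 4k)` (arising from pre-existing scores `(6k, 4k, 2k, 0)` with
`n = 2k` manipulators), every `2k`-manipulation matrix is the one in which
every manipulator casts the vote `4 > 3 > 2 > 1`. -/
theorem borda_thm2_unique_manipulation
    (k : ℕ) (hk : 1 ≤ k)
    (g : Fin 4 → ℤ)
    (hg : g 0 = 0 ∧ g 1 = 2 * (k : ℤ) ∧ g 2 = 4 * (k : ℤ))
    (A : Matrix (Fin (2 * k)) (Fin 4) ℕ)
    (hA : IsManipMatrix (2 * k) 4 3 g A) :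
    A = Matrix.of fun _ (j : Fin 4) => (j : ℕ) := by
  obtain ⟨hd, himg, hgap⟩ := hA
  obtain ⟨hg0, hg1, hg2⟩ := hg
  have hinj (r : Fin (2 * k)) : Function.Injective (A r) := by
    rw [← Set.injOn_univ, ← Finset.coe_univ, ← Finset.card_image_iff, himg r]
    simp
  have h0 (r : Fin (2 * k)) : A r 0 = 0 := by
    refine eq_const_of_sum_le (f := fun r => A r 0) (fun _ => Nat.zero_le _) ?_ r
    simpa [hg0] using hgap 0 (by decide)
  have h1 (r : Fin (2 * k)) : A r 1 = 1 := by
    refine eq_const_of_sum_le (f := fun r => A r 1) (fun r => ?_) ?_ r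
    · have := (hinj r).ne (show (1 : Fin 4) ≠ 0 by decide)
      have := h0 r
      omega
    · simpa [hg1] using hgap 1 (by decide)
  have h2 (r : Fin (2 * k)) : A r 2 = 2 := by
    refine eq_const_of_sum_le (f := fun r => A r 2) (fun r => ?_) ?_ r
    · have := (hinj r).ne (show (2 : Fin 4) ≠ 0 by decide)
      have := (hinj r).ne (show (2 : Fin 4) ≠ 1 by decide)
      have := h0 r
      have := h1 r
      omega
    · have := hgap 2 (by decide)
      push_cast
      linarith
  ext r j
  fin_cases j
  · exact h0 r
  · exact h1 r
  · exact h2 r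
  · exact hd r
end
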